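/- There exists a subgroup G of the Baer–Specker group ℤ^ℕ such that G has the Menger property (in particular, G is Menger-bounded), but G is not Hurewicz-bounded and not Rothberger-bounded. -/

import Mathlib

open Filter Set Topology Pointwise

def MengerBounded (G : Type*) [AddGroup G] [TopologicalSpace G] : Prop :=
  ∀ U : ℕ → Set G, (∀ n, U n ∈ nhds (0 : G)) →
    ∃ F : ℕ → Finset G, ∀ g : G, ∃ n, g ∈ (F n : Set G) + U n

def ScheepersBounded (G : Type*) [AddGroup G] [TopologicalSpace G] : Prop :=
  ∀ U : ℕ → Set G, (∀ n, U n ∈ nhds (0 : G)) →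
    ∃ F : ℕ → Finset G, ∀ E : Finset G, ∃ n, (E : Set G) ⊆ (F n : Set G) + U n

def HurewiczBounded (G : Type*) [AddGroup G] [TopologicalSpace G] : Prop :=
  ∀ U : ℕ → Set G, (∀ n, U n ∈ nhds (0 : G)) →
    ∃ F : ℕ → Finset G, ∀ g : G, ∀ᶠ n in atTop, g ∈ (F n : Set G) + U n

def RothbergerBounded (G : Type*) [AddGroup G] [TopologicalSpace G] : Prop :=
  ∀ U : ℕ → Set G, (∀ n, U n ∈ nhds (0 : G)) →
    ∃ a : ℕ → G, ∀ g : G, ∃ n, g ∈ ({a n} : Set G) + U n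

def HasMenger (X : Type*) [TopologicalSpace X] : Prop :=
  ∀ U : ℕ → Set (Set X), (∀ n, ∀ u ∈ U n, IsOpen u) → (∀ n, ⋃₀ U n = univ) →
    ∃ F : ℕ → Set (Set X), (∀ n, (F n).Finite ∧ F n ⊆ U n) ∧ ⋃ n, ⋃₀ F n = univ

def HasScheepers (X : Type*) [TopologicalSpace X] : Prop :=
  ∀ U : ℕ → Set (Set X), (∀ n, ∀ u ∈ U n, IsOpen u) → (∀ n, ⋃₀ U n = univ) →
    ∃ F : ℕ → Set (Set X), (∀ n, (F n).Finite ∧ F n ⊆ U n) ∧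
      ∀ E : Set X, E.Finite → ∃ n, E ⊆ ⋃₀ F n

def HasHurewicz (X : Type*) [TopologicalSpace X] : Prop :=
  ∀ U : ℕ → Set (Set X), (∀ n, ∀ u ∈ U n, IsOpen u) → (∀ n, ⋃₀ U n = univ) →
    ∃ F : ℕ → Set (Set X), (∀ n, (F n).Finite ∧ F n ⊆ U n) ∧
      ∀ x : X, ∀ᶠ n in atTop, x ∈ ⋃₀ F n

def HasRothberger (X : Type*) [TopologicalSpace X] : Prop :=
  ∀ U : ℕ → Set (Set X), (∀ n, ∀ u ∈ U n, IsOpen u) → (∀ n, ⋃₀ U n = univ) →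
    ∃ u : ℕ → Set X, (∀ n, u n ∈ U n) ∧ ⋃ n, u n = univ

def MengerBddSet (Y : Set (ℕ → ℤ)) : Prop :=
  ∃ f : ℕ → ℕ, ∀ y ∈ Y, ∃ᶠ n in atTop, ∀ i < n, |y i| ≤ (f n : ℤ)

def ScheepersBddSet (Y : Set (ℕ → ℤ)) : Prop :=
  ∃ f : ℕ → ℕ, ∀ F : Finset (ℕ → ℤ), (F : Set (ℕ → ℤ)) ⊆ Y →
    ∃ᶠ n in atTop, ∀ y ∈ F, ∀ i < n, y i ≤ (f n : ℤ)

def HurewiczBddSet (Y : Set (ℕ → ℤ)) : Prop :=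
  ∃ f : ℕ → ℕ, ∀ y ∈ Y, ∀ᶠ n in atTop, |y n| ≤ (f n : ℤ)

def RothbergerBddSet (Y : Set (ℕ → ℤ)) : Prop :=
  ∀ h : ℕ → ℕ, StrictMono h → ∃ φ : (n : ℕ) → Fin (h n) → ℤ,
    ∀ y ∈ Y, ∃ n, ∀ i : Fin (h n), y i.val = φ n i

noncomputable def frakb : Cardinal :=
  sInf {c : Cardinal | ∃ B : Set (ℕ → ℕ),
    (∀ g : ℕ → ℕ, ∃ f ∈ B, ¬ ∀ᶠ n in atTop, f n ≤ g n) ∧ Cardinal.mk ↥B = c}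

noncomputable def frakd : Cardinal :=
  sInf {c : Cardinal | ∃ D : Set (ℕ → ℕ),
    (∀ g : ℕ → ℕ, ∃ f ∈ D, ∀ᶠ n in atTop, g n ≤ f n) ∧ Cardinal.mk ↥D = c}

noncomputable def covMeager : Cardinal :=
  sInf {c : Cardinal | ∃ Y : Set (ℕ → ℕ),
    (¬ ∃ f : ℕ → ℕ, ∀ y ∈ Y, ∃ n, f n = y n) ∧ Cardinal.mk ↥Y = c}

open Classical in
noncomputable def specDist (x y : ℕ → ℤ) : ℝ :=
  if x = y then 0 else 1 / (((sInf {n | x n ≠ y n} : ℕ) : ℝ) + 1)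

def HasSMZ (S : Set (ℕ → ℤ)) : Prop :=
  ∀ ε : ℕ → ℝ, (∀ n, 0 < ε n) →
    ∃ U : ℕ → Set (ℕ → ℤ), S ⊆ ⋃ n, U n ∧
      ∀ n, ∀ x ∈ U n, ∀ y ∈ U n, specDist x y < ε n

def HurewiczBoundedMul (G : Type*) [Group G] [TopologicalSpace G] : Prop :=
  ∀ U : ℕ → Set G, (∀ n, U n ∈ nhds (1 : G)) →
    ∃ F : ℕ → Finset G, ∀ g : G, ∀ᶠ n in atTop, g ∈ (F n : Set G) * U n

def LeftTotallyBounded {G : Type*} [Group G] [TopologicalSpace G] (B : Set G) : Prop :=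
  ∀ U ∈ nhds (1 : G), ∃ F : Finset G, B ⊆ (F : Set G) * U

def TotallyBoundedIn {G : Type*} [Group G] [TopologicalSpace G] (B : Set G) : Prop :=
  ∀ U ∈ nhds (1 : G), ∃ F : Finset G, B ⊆ ((F : Set G) * U) ∩ (U * (F : Set G))

/-- The Menger property of a subset of a space, for countable covers by open sets of the space. -/
def MengerOn {Z : Type*} [TopologicalSpace Z] (A : Set Z) : Prop :=
  ∀ U : ℕ → ℕ → Set Z, (∀ n m, IsOpen (U n m)) → (∀ n, A ⊆ ⋃ m, U n m) →
    ∃ g : ℕ → ℕ, ∀ a ∈ A, ∃ n, ∃ m ≤ g n, a ∈ U n m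

section MengerOn

variable {Z : Type*} [TopologicalSpace Z]

theorem MengerOn.exists_frequently {A : Set Z} (hA : MengerOn A) {U : ℕ → ℕ → Set Z}
    (hU : ∀ n m, IsOpen (U n m)) (hAU : ∀ n, A ⊆ ⋃ m, U n m) :
    ∃ g : ℕ → ℕ, ∀ a ∈ A, ∃ᶠ n in atTop, ∃ m ≤ g n, a ∈ U n m := by
  choose G hG using fun k => hA (fun n => U (n + k)) (fun n => hU _) (fun n => hAU _)
  refine ⟨fun n => (Finset.range (n + 1)).sup fun k => G k (n - k), fun a ha => ?_⟩
  rw [frequently_atTop]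
  intro N
  obtain ⟨n, m, hm, ham⟩ := hG N a ha
  refine ⟨n + N, by lia, m, hm.trans ?_, ham⟩
  have := Finset.le_sup (f := fun k => G k (n + N - k))
    (Finset.mem_range.2 (by lia : N < n + N + 1))
  simpa using this

theorem MengerOn.iUnion {ι : Type*} {A : ι → Set Z}
    (hι : ∀ f : ι → ℕ → ℕ, ∃ g : ℕ → ℕ, ∀ i, ∀ᶠ n in atTop, f i n ≤ g n)
    (hA : ∀ i, MengerOn (A i)) : MengerOn (⋃ i, A i) := by
  intro U hU hAU
  choose f hf using fun i => (hA i).exists_frequently hU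
    (fun n => (subset_iUnion A i).trans (hAU n))
  obtain ⟨g, hg⟩ := hι f
  refine ⟨g, fun a ha => ?_⟩
  obtain ⟨i, hi⟩ := mem_iUnion.1 ha
  obtain ⟨n, ⟨m, hm, ham⟩, hn⟩ := ((hf i a hi).and_eventually (hg i)).exists
  exact ⟨n, m, hm.trans hn, ham⟩

theorem MengerOn.iUnion_nat {A : ℕ → Set Z} (hA : ∀ i, MengerOn (A i)) :
    MengerOn (⋃ i, A i) := by
  refine MengerOn.iUnion (fun f => ⟨fun n => (Finset.range (n + 1)).sup fun i => f i n,
    fun i => ?_⟩) hA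
  filter_upwards [eventually_ge_atTop i] with n hn
  exact Finset.le_sup (f := fun i => f i n) (Finset.mem_range.2 (by lia : i < n + 1))

theorem IsCompact.exists_subset_iUnion_le {K : Set Z} (hK : IsCompact K) {V : ℕ → Set Z}
    (hV : ∀ m, IsOpen (V m)) (hKV : K ⊆ ⋃ m, V m) : ∃ N, ∀ a ∈ K, ∃ m ≤ N, a ∈ V m := by
  obtain ⟨t, ht⟩ := hK.elim_finite_subcover V hV hKV
  refine ⟨t.sup id, fun a ha => ?_⟩
  obtain ⟨m, hm, ham⟩ := mem_iUnion₂.1 (ht ha)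
  exact ⟨m, Finset.le_sup (f := id) hm, ham⟩

theorem MengerOn.iUnion_of_isCompact {ι : Type*} {K : ι → Set Z}
    (hι : ∀ f : ι → ℕ → ℕ, ∃ g : ℕ → ℕ, ∀ i, ∃ n, f i n ≤ g n)
    (hK : ∀ i, IsCompact (K i)) : MengerOn (⋃ i, K i) := by
  intro U hU hKU
  choose f hf using fun i n => (hK i).exists_subset_iUnion_le (hU n)
    ((subset_iUnion K i).trans (hKU n))
  obtain ⟨g, hg⟩ := hι f
  refine ⟨g, fun a ha => ?_⟩
  obtain ⟨i, hi⟩ := mem_iUnion.1 ha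
  obtain ⟨n, hn⟩ := hg i
  obtain ⟨m, hm, ham⟩ := hf i n a hi
  exact ⟨n, m, hm.trans hn, ham⟩

theorem IsCompact.mengerOn {K : Set Z} (hK : IsCompact K) : MengerOn K := by
  rw [← Set.iUnion_const (ι := Unit) K]
  exact MengerOn.iUnion_of_isCompact (fun f => ⟨f (), fun _ => ⟨0, le_rfl⟩⟩) (fun _ => hK)

theorem MengerOn.hasMenger [SecondCountableTopology Z] {A : Set Z} (hA : MengerOn A)
    (hne : A.Nonempty) : HasMenger A := by
  intro U hU hcov
  have key : ∀ n, ∃ V : ℕ → Set Z, (∀ m, IsOpen (V m)) ∧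
      (∀ m, (Subtype.val ⁻¹' V m : Set A) ∈ U n) ∧ A ⊆ ⋃ m, V m := by
    intro n
    obtain ⟨T, hTc, hTU, hT⟩ := TopologicalSpace.isOpen_sUnion_countable (U n) (hU n)
    rw [hcov n] at hT
    have hTne : T.Nonempty := by
      obtain ⟨a, ha⟩ := hne
      obtain ⟨t, ht, -⟩ := hT.symm.subset (mem_univ (⟨a, ha⟩ : A))
      exact ⟨t, ht⟩
    obtain ⟨f, rfl⟩ := hTc.exists_eq_range hTne
    choose V hVo hV using fun m => isOpen_induced_iff.1 (hU n (f m) (hTU ⟨m, rfl⟩))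
    refine ⟨V, hVo, fun m => by rw [hV]; exact hTU ⟨m, rfl⟩, fun a ha => ?_⟩
    obtain ⟨_, ⟨m, rfl⟩, hm⟩ := hT.symm.subset (mem_univ (⟨a, ha⟩ : A))
    rw [← hV] at hm
    exact mem_iUnion.2 ⟨m, hm⟩
  choose V hVo hVU hVA using key
  obtain ⟨g, hg⟩ := hA V hVo hVA
  refine ⟨fun n => (fun m => (Subtype.val ⁻¹' V n m : Set A)) '' Iic (g n),
    fun n => ⟨(finite_Iic _).image _, ?_⟩, eq_univ_of_forall fun a => ?_⟩
  · rintro _ ⟨m, -, rfl⟩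
    exact hVU n m
  · obtain ⟨n, m, hm, ham⟩ := hg a a.2
    exact mem_iUnion.2 ⟨n, _, ⟨m, hm, rfl⟩, ham⟩

end MengerOn

theorem HasMenger.mengerBounded {G : Type*} [AddGroup G] [TopologicalSpace G]
    [IsTopologicalAddGroup G] (hG : HasMenger G) : MengerBounded G := by
  intro U hU
  obtain ⟨F, hF, hcov⟩ := hG (fun n => range fun g : G => (fun x => -g + x) ⁻¹' interior (U n))
    (by
      rintro n _ ⟨g, rfl⟩
      exact isOpen_interior.preimage (by fun_prop))
    (fun n => eq_univ_of_forall fun g => ⟨_, ⟨g, rfl⟩, by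
      simpa using mem_interior_iff_mem_nhds.2 (hU n)⟩)
  have key : ∀ n, ∃ E : Finset G, ⋃₀ F n ⊆ (E : Set G) + U n := by
    intro n
    classical
    choose! c hc using fun u (hu : u ∈ F n) => (hF n).2 hu
    replace hc : ∀ u ∈ F n, (fun x => -c u + x) ⁻¹' interior (U n) = u := hc
    refine ⟨(hF n).1.toFinset.image c, ?_⟩
    rintro x ⟨u, hu, hxu⟩
    rw [← hc u hu] at hxu
    refine ⟨c u, by simpa using ⟨u, hu, rfl⟩, -c u + x, interior_subset hxu, by simp⟩
  choose E hE using key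
  refine ⟨E, fun g => ?_⟩
  obtain ⟨n, hn⟩ := mem_iUnion.1 (hcov.symm.subset (mem_univ g))
  exact ⟨n, hE n hn⟩

/-- The group of bounded integer sequences. -/
def boundedSeq : AddSubgroup (ℕ → ℤ) where
  carrier := {x | ∃ N : ℕ, ∀ j, |x j| ≤ N}
  zero_mem' := ⟨0, by simp⟩
  add_mem' := by
    rintro x y ⟨M, hM⟩ ⟨N, hN⟩
    exact ⟨M + N, fun j => (abs_add_le _ _).trans (by push_cast; exact add_le_add (hM j) (hN j))⟩
  neg_mem' := by
    rintro x ⟨N, hN⟩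
    exact ⟨N, by simpa using hN⟩

theorem isCompact_setOf_abs_le (c : ℕ → ℤ) : IsCompact {x : ℕ → ℤ | ∀ j, |x j| ≤ c j} := by
  have : {x : ℕ → ℤ | ∀ j, |x j| ≤ c j} = univ.pi fun j => Icc (-c j) (c j) := by
    ext x
    simp only [Set.mem_pi, mem_ofPred_eq, abs_le, mem_univ, true_imp_iff, mem_Icc]
  rw [this]
  exact isCompact_univ_pi fun j => (finite_Icc _ _).isCompact

theorem AddSubgroup.setOf_apply_eq_zero_mem_nhds (G : AddSubgroup (ℕ → ℤ)) (n : ℕ) :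
    {x : G | (x : ℕ → ℤ) n = 0} ∈ nhds (0 : G) := by
  have hc : Continuous fun x : G => (x : ℕ → ℤ) n :=
    (continuous_apply n).comp continuous_subtype_val
  exact ((isOpen_discrete {(0 : ℤ)}).preimage hc).mem_nhds (by simp)

theorem not_hurewiczBounded_of_unbounded {G : AddSubgroup (ℕ → ℤ)}
    (hG : ∀ f : ℕ → ℕ, ∃ x ∈ G, ∃ᶠ n in atTop, (f n : ℤ) < |x n|) :
    ¬ HurewiczBounded G := by
  intro h
  obtain ⟨F, hF⟩ := h _ G.setOf_apply_eq_zero_mem_nhds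
  obtain ⟨x, hx, hfx⟩ := hG fun n => (F n).sup fun a => ((a : ℕ → ℤ) n).natAbs
  obtain ⟨n, hn, hn'⟩ := (hfx.and_eventually (hF ⟨x, hx⟩)).exists
  obtain ⟨a, ha, u, hu, hau⟩ := hn'
  have h1 : x n = (a : ℕ → ℤ) n := by
    have := congrArg (fun z : G => (z : ℕ → ℤ) n) hau
    have hu' : (u : ℕ → ℤ) n = 0 := hu
    simpa [hu'] using this.symm
  have h2 := Finset.le_sup (f := fun a : G => ((a : ℕ → ℤ) n).natAbs) ha
  rw [h1] at hn
  have h3 : (((F n).sup fun a : G => ((a : ℕ → ℤ) n).natAbs : ℕ) : ℤ) <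
    (((a : ℕ → ℤ) n).natAbs : ℤ) := by simpa using hn
  exact absurd h2 (not_le.2 (by exact_mod_cast h3))

theorem not_rothbergerBounded_of_boundedSeq_le {G : AddSubgroup (ℕ → ℤ)}
    (hG : boundedSeq ≤ G) : ¬ RothbergerBounded G := by
  intro h
  obtain ⟨a, ha⟩ := h _ G.setOf_apply_eq_zero_mem_nhds
  have hx : (fun n => if (a n : ℕ → ℤ) n = 0 then 1 else 0 : ℕ → ℤ) ∈ boundedSeq :=
    ⟨1, fun j => by dsimp only; split_ifs <;> simp⟩
  obtain ⟨n, b, hb, u, hu, hau⟩ := ha ⟨_, hG hx⟩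
  have hu' : (u : ℕ → ℤ) n = 0 := hu
  have hb' : b = a n := hb
  subst hb'
  have := congrArg (fun z : G => (z : ℕ → ℤ) n) hau
  simp only [AddSubgroup.coe_add, Pi.add_apply, hu', add_zero] at this
  split_ifs at this with h0 <;> simp_all

theorem exists_subgroup_of_unbounded {H : AddSubgroup (ℕ → ℤ)}
    (hH : ∀ f : ℕ → ℕ, ∃ x ∈ H, ∃ᶠ n in atTop, (f n : ℤ) < |x n|)
    (hM : ∀ K : Set (ℕ → ℤ), IsCompact K → MengerOn ((H : Set (ℕ → ℤ)) + K)) :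
    ∃ G : AddSubgroup (ℕ → ℤ), HasMenger ↥G ∧ MengerBounded ↥G ∧
      ¬ HurewiczBounded ↥G ∧ ¬ RothbergerBounded ↥G := by
  have hG : ((H ⊔ boundedSeq : AddSubgroup (ℕ → ℤ)) : Set (ℕ → ℤ)) =
      ⋃ N : ℕ, ((H : Set (ℕ → ℤ)) + {x | ∀ j, |x j| ≤ ((fun _ => N : ℕ → ℤ)) j}) := by
    ext x
    simp only [SetLike.mem_coe, AddSubgroup.mem_sup, mem_iUnion, Set.mem_add]
    constructor
    · rintro ⟨y, hy, z, ⟨N, hN⟩, rfl⟩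
      exact ⟨N, y, hy, z, hN, rfl⟩
    · rintro ⟨N, y, hy, z, hN, rfl⟩
      exact ⟨y, hy, z, ⟨N, hN⟩, rfl⟩
  have hMenger : HasMenger ↥(H ⊔ boundedSeq : AddSubgroup (ℕ → ℤ)) := by
    refine MengerOn.hasMenger (A := ((H ⊔ boundedSeq : AddSubgroup (ℕ → ℤ)) : Set (ℕ → ℤ)))
      ?_ ⟨0, zero_mem _⟩
    rw [hG]
    exact MengerOn.iUnion_nat fun N => hM _ (isCompact_setOf_abs_le _)
  refine ⟨H ⊔ boundedSeq, hMenger, hMenger.mengerBounded,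
    not_hurewiczBounded_of_unbounded fun f => ?_, not_rothbergerBounded_of_boundedSeq_le le_sup_right⟩
  obtain ⟨x, hx, hfx⟩ := hH f
  exact ⟨x, AddSubgroup.mem_sup_left hx, hfx⟩

theorem IsCompact.exists_cylinder_subset {C O : Set (ℕ → ℤ)} (hC : IsCompact C) (hO : IsOpen O)
    (hCO : C ⊆ O) : ∃ m, ∀ w ∈ C, PiNat.cylinder w m ⊆ O := by
  have hmono : Monotone fun m => {w : ℕ → ℤ | PiNat.cylinder w m ⊆ O} :=
    fun m n hmn w hw => (PiNat.cylinder_anti w hmn).trans hw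
  have hopen : ∀ m, IsOpen {w : ℕ → ℤ | PiNat.cylinder w m ⊆ O} := by
    refine fun m => isOpen_iff_mem_nhds.2 fun w hw => ?_
    filter_upwards [(PiNat.isOpen_cylinder (fun _ => ℤ) w m).mem_nhds
      (PiNat.self_mem_cylinder w m)] with v hv
    rw [PiNat.mem_cylinder_iff_eq] at hv
    rwa [hv]
  have hcover : C ⊆ ⋃ m, {w : ℕ → ℤ | PiNat.cylinder w m ⊆ O} := by
    intro w hw
    obtain ⟨_, ⟨v, m, rfl⟩, hwv, hvO⟩ :=
      (PiNat.isTopologicalBasis_cylinders fun _ => ℤ).exists_subset_of_mem_open (hCO hw) hO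
    rw [PiNat.mem_cylinder_iff_eq] at hwv
    exact mem_iUnion.2 ⟨m, hwv.subset.trans hvO⟩
  obtain ⟨m, hm⟩ := hC.elim_directed_cover _ hopen hcover hmono.directed_le
  exact ⟨m, fun w hw => hm hw⟩

/-- The sequence `y` has values at most `n` up to `n`, and vanishes from `n` to `g n`. -/
def IsGap (g : ℕ → ℕ) (y : ℕ → ℤ) (n : ℕ) : Prop :=
  (∀ j < n, |y j| ≤ n) ∧ ∀ j, n ≤ j → j ≤ g n → y j = 0

theorem IsGap.mono {f g : ℕ → ℕ} {y : ℕ → ℤ} {n : ℕ} (h : IsGap g y n) (hfg : f n ≤ g n) :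
    IsGap f y n :=
  ⟨h.1, fun j hj hj' => h.2 j hj (hj'.trans hfg)⟩

theorem IsGap.neg {g : ℕ → ℕ} {y : ℕ → ℤ} {n : ℕ} (h : IsGap g y n) : IsGap g (-y) n :=
  ⟨by simpa using h.1, by simpa using h.2⟩

theorem exists_gaps_and_large (g : ℕ → ℕ) : ∃ y : ℕ → ℤ,
    (∀ᶠ n in (hyperfilter ℕ : Filter ℕ), IsGap g y n) ∧ ∃ᶠ n in atTop, (g n : ℤ) < |y n| := by
  wlog hg : Monotone g generalizing g
  · obtain ⟨y, hy, hy'⟩ := this (partialSups g) (partialSups g).monotone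
    exact ⟨y, hy.mono fun n hn => hn.mono (le_partialSups g n), hy'.mono fun n hn =>
      lt_of_le_of_lt (by exact_mod_cast le_partialSups g n) hn⟩
  let c : ℕ → ℕ := fun k => Nat.rec 0 (fun _ a => max (g a) a + 1) k
  have hc0 : c 0 = 0 := rfl
  have hcs : ∀ k, c (k + 1) = max (g (c k)) (c k) + 1 := fun k => rfl
  have hmono : StrictMono c := strictMono_nat_of_lt_succ fun k => by rw [hcs]; lia
  have hidx : ∀ n, ∃ k, c k ≤ n ∧ n < c (k + 1) := by
    intro n
    induction n with
    | zero => exact ⟨0, by simp [hc0], by rw [hcs]; lia⟩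
    | succ n ih =>
      obtain ⟨k, hk, hk'⟩ := ih
      rcases Nat.lt_or_ge (n + 1) (c (k + 1)) with h | h
      · exact ⟨k, by lia, h⟩
      · exact ⟨k + 1, h, by have := hmono (by lia : k + 1 < k + 1 + 1); lia⟩
  choose i hi hi' using hidx
  have hile : ∀ n k, n < c (k + 1) → i n ≤ k := fun n k h =>
    Nat.lt_succ_iff.1 (hmono.lt_iff_lt.1 ((hi n).trans_lt h))
  have hile' : ∀ n k, c k ≤ n → k ≤ i n := fun n k h =>
    Nat.lt_succ_iff.1 (hmono.lt_iff_lt.1 (h.trans_lt (hi' n)))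
  obtain ⟨r, hr3, hr⟩ : ∃ r < 3, ∀ᶠ n in (hyperfilter ℕ : Filter ℕ), i n % 3 = r := by
    have : ∀ᶠ n in (hyperfilter ℕ : Filter ℕ), i n % 3 = 0 ∨ i n % 3 = 1 ∨ i n % 3 = 2 :=
      Eventually.of_forall fun n => by lia
    rw [Ultrafilter.eventually_or, Ultrafilter.eventually_or] at this
    rcases this with h | h | h
    exacts [⟨0, by lia, h⟩, ⟨1, by lia, h⟩, ⟨2, by lia, h⟩]
  refine ⟨fun j => if (i j + 1) % 3 = r then (c (i j + 1) : ℤ) else 0,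
    hr.mono fun n hn => ⟨fun j hj => ?_, fun j hj hj' => ?_⟩, ?_⟩
  · dsimp only
    split_ifs with h
    · have h1 : i j ≤ i n := hile _ _ (hj.trans (hi' n))
      have h2 : c (i j + 1) ≤ c (i n) := hmono.monotone (by lia : i j + 1 ≤ i n)
      have := hi n
      rw [Nat.abs_cast]
      exact_mod_cast h2.trans this
    · simp
  · have h1 : i n ≤ i j := hile' _ _ ((hi n).trans hj)
    have h2 : i j ≤ i n + 1 := by
      refine hile _ _ (hj'.trans_lt ?_)
      have := hg (hi' n).le
      rw [hcs (i n + 1)]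
      lia
    exact if_neg (by lia)
  · rw [frequently_atTop]
    intro N
    obtain ⟨k, hk, hkr⟩ : ∃ k ≥ N, (k + 1) % 3 = r := ⟨3 * N + r + 2, by lia, by lia⟩
    have hik : i (c k) = k := le_antisymm (hile _ _ (hmono (Nat.lt_succ_self k))) (hile' _ _ le_rfl)
    refine ⟨c k, hk.le.trans (hmono.id_le k), ?_⟩
    simp only [hik, hkr, if_true, Nat.abs_cast]
    rw [hcs]
    exact_mod_cast by lia

/-- The set of sums of `k` elements of `Y` and one element of `K`. -/
def sumsAdd (Y : Set (ℕ → ℤ)) (k : ℕ) (K : Set (ℕ → ℤ)) : Set (ℕ → ℤ) :=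
  {x | ∃ l : Multiset (ℕ → ℤ), l.card = k ∧ (∀ y ∈ l, y ∈ Y) ∧ ∃ z ∈ K, x = l.sum + z}

/-- The set of sequences bounded by `b` which vanish from `n` on. -/
def box (n b : ℕ) : Set (ℕ → ℤ) := {x | ∀ j, |x j| ≤ ((if j < n then b else 0 : ℕ) : ℤ)}

theorem isCompact_box (n b : ℕ) : IsCompact (box n b) := isCompact_setOf_abs_le _

theorem eventually_isGap_of_mem_box {n b : ℕ} {x : ℕ → ℤ} (hx : x ∈ box n b) (g : ℕ → ℕ) :
    ∀ᶠ m in (hyperfilter ℕ : Filter ℕ), IsGap g x m := by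
  have : (hyperfilter ℕ : Filter ℕ) ≤ atTop := Nat.cofinite_eq_atTop ▸ hyperfilter_le_cofinite
  refine this ?_
  filter_upwards [eventually_ge_atTop n, eventually_ge_atTop b] with m hm hm'
  refine ⟨fun j hj => (hx j).trans ?_, fun j hj _ => ?_⟩
  · split_ifs <;> norm_cast
    lia
  · have := hx j
    rw [if_neg (by lia)] at this
    simpa using this

theorem abs_multiset_sum_apply_le {l : Multiset (ℕ → ℤ)} {j : ℕ} {c : ℤ}
    (h : ∀ y ∈ l, |y j| ≤ c) : |l.sum j| ≤ l.card * c := by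
  induction l using Multiset.induction with
  | empty => simp
  | cons a l ih =>
    have h1 := ih fun y hy => h y (Multiset.mem_cons_of_mem hy)
    have h2 := h a (Multiset.mem_cons_self a l)
    rw [Multiset.sum_cons, Pi.add_apply, Multiset.card_cons]
    refine (abs_add_le _ _).trans ?_
    push_cast
    linarith

/-- If an open set contains the translates of a compact set by all boxes, then it contains all
translates by sums of `k` sequences having a common gap for a suitable `g`. -/
theorem exists_gap_function {K O : Set (ℕ → ℤ)} (hK : IsCompact K) (hO : IsOpen O)
    (hKO : ∀ n b, box n b + K ⊆ O) (k : ℕ) : ∃ g : ℕ → ℕ, ∀ l : Multiset (ℕ → ℤ), l.card = k →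
      ∀ n, (∀ y ∈ l, IsGap g y n) → ∀ z ∈ K, l.sum + z ∈ O := by
  choose g hg using fun n =>
    ((isCompact_box n (k * n)).add hK).exists_cylinder_subset hO (hKO n (k * n))
  refine ⟨g, fun l hl n hn z hz => ?_⟩
  let w : ℕ → ℤ := fun j => if j < n then l.sum j else 0
  have hw : w ∈ box n (k * n) := by
    intro j
    by_cases hj : j < n
    · simp only [w, if_pos hj]
      rw [← hl]
      push_cast
      exact abs_multiset_sum_apply_le fun y hy => (hn y hy).1 j hj
    · simp [w, hj]
  refine hg n (w + z) (Set.add_mem_add hw hz) ?_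
  intro j hj
  simp only [Pi.add_apply, add_left_inj, w]
  split_ifs with hjn
  · rfl
  · have := abs_multiset_sum_apply_le (l := l) (j := j) (c := 0) fun y hy => by
      rw [(hn y hy).2 j (by lia) hj.le, abs_zero]
    simpa using this

theorem mengerOn_sumsAdd {Y : Set (ℕ → ℤ)} (hbox : ∀ n b, box n b ⊆ Y)
    (hY : ∀ g : ℕ → ℕ, ∃ S : Set (ℕ → ℤ), S ⊆ Y ∧
      (∀ f : S → ℕ → ℕ, ∃ h : ℕ → ℕ, ∀ i, ∀ᶠ n in atTop, f i n ≤ h n) ∧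
      ∀ y ∈ Y, y ∉ S → ∀ᶠ n in (hyperfilter ℕ : Filter ℕ), IsGap g y n)
    (k : ℕ) {K : Set (ℕ → ℤ)} (hK : IsCompact K) : MengerOn (sumsAdd Y k K) := by
  have h0 : (0 : ℕ → ℤ) ∈ Y := hbox 0 0 (by simp [box])
  classical
  induction k generalizing K with
  | zero =>
    have : sumsAdd Y 0 K = K := by
      ext x
      simp [sumsAdd, Multiset.card_eq_zero]
    rw [this]
    exact hK.mengerOn
  | succ k ih =>
    intro U hU hAU
    have hboxsub : (⋃ N, (box N N + K)) ⊆ sumsAdd Y (k + 1) K := by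
      refine iUnion_subset fun N => ?_
      rintro _ ⟨q, hq, z, hz, rfl⟩
      refine ⟨q ::ₘ Multiset.replicate k 0, by simp, fun y hy => ?_, z, hz, by simp⟩
      rcases Multiset.mem_cons.1 hy with rfl | hy
      · exact hbox _ _ hq
      · rwa [Multiset.eq_of_mem_replicate hy]
    obtain ⟨g₀, hg₀⟩ := MengerOn.iUnion_nat
      (fun N => ((isCompact_box N N).add hK).mengerOn) U hU fun n => hboxsub.trans (hAU n)
    let O : Set (ℕ → ℤ) := ⋃ n, ⋃ m ∈ Iic (g₀ n), U n m
    have hOo : IsOpen O := isOpen_iUnion fun n => isOpen_biUnion fun m _ => hU n m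
    have hKO : ∀ n b, box n b + K ⊆ O := by
      rintro n b _ ⟨q, hq, z, hz, rfl⟩
      have hq' : q ∈ box (max n b) (max n b) := by
        intro j
        refine (hq j).trans ?_
        norm_cast
        split_ifs <;> lia
      obtain ⟨N, m, hm, h⟩ := hg₀ (q + z) (mem_iUnion.2 ⟨_, Set.add_mem_add hq' hz⟩)
      exact mem_iUnion.2 ⟨N, mem_iUnion₂.2 ⟨m, hm, h⟩⟩
    obtain ⟨g, hg⟩ := exists_gap_function hK hOo hKO (k + 1)
    obtain ⟨S, hSY, hS, hgap⟩ := hY g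
    have hrest : (⋃ y : S, sumsAdd Y k ({(y : ℕ → ℤ)} + K)) ⊆ sumsAdd Y (k + 1) K := by
      refine iUnion_subset fun y => ?_
      rintro _ ⟨l, hl, hlY, _, ⟨_, rfl, z, hz, rfl⟩, rfl⟩
      refine ⟨y ::ₘ l, by simp [hl], ?_, z, hz, ?_⟩
      · intro v hv
        rcases Multiset.mem_cons.1 hv with rfl | hv
        exacts [hSY y.2, hlY v hv]
      · simp only [Multiset.sum_cons, add_left_comm, add_assoc]
    obtain ⟨g₁, hg₁⟩ := MengerOn.iUnion hS (fun y => ih (isCompact_singleton.add hK)) U hU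
      fun n => hrest.trans (hAU n)
    refine ⟨fun n => max (g₀ n) (g₁ n), ?_⟩
    rintro _ ⟨l, hl, hlY, z, hz, rfl⟩
    by_cases hlS : ∃ y ∈ l, y ∈ S
    · obtain ⟨y, hyl, hyS⟩ := hlS
      obtain ⟨l, rfl⟩ := Multiset.exists_cons_of_mem hyl
      obtain ⟨n, m, hm, h⟩ := hg₁ ((y ::ₘ l).sum + z) (mem_iUnion.2 ⟨⟨y, hyS⟩, l,
        by simpa using hl, fun v hv => hlY v (Multiset.mem_cons_of_mem hv), y + z,
        Set.add_mem_add rfl hz, by rw [Multiset.sum_cons]; abel⟩)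
      exact ⟨n, m, hm.trans (le_max_right _ _), h⟩
    · push Not at hlS
      have hall : ∀ᶠ n in (hyperfilter ℕ : Filter ℕ), ∀ y ∈ l.toFinset, IsGap g y n :=
        (eventually_all_finset _).2 fun y hy => by
          rw [Multiset.mem_toFinset] at hy
          exact hgap y (hlY y hy) (hlS y hy)
      obtain ⟨n, hn⟩ := hall.exists
      obtain ⟨N, hN⟩ := mem_iUnion.1
        (hg l hl n (fun y hy => hn y (Multiset.mem_toFinset.2 hy)) z hz)
      obtain ⟨m, hm, h⟩ := mem_iUnion₂.1 hN
      exact ⟨N, m, le_trans hm (le_max_left _ _), h⟩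

theorem exists_dominating_mk_eq_frakd : ∃ D : Set (ℕ → ℕ),
    (∀ g : ℕ → ℕ, ∃ f ∈ D, ∀ᶠ n in atTop, g n ≤ f n) ∧ Cardinal.mk D = frakd :=
  csInf_mem (s := {c : Cardinal | ∃ D : Set (ℕ → ℕ),
    (∀ g : ℕ → ℕ, ∃ f ∈ D, ∀ᶠ n in atTop, g n ≤ f n) ∧ Cardinal.mk ↥D = c})
    ⟨_, univ, fun g => ⟨g, mem_univ g, Eventually.of_forall fun _ => le_rfl⟩, rfl⟩

theorem exists_forall_exists_le_of_mk_lt_frakd {ι : Type} (hι : Cardinal.mk ι < frakd)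
    (f : ι → ℕ → ℕ) : ∃ g : ℕ → ℕ, ∀ i, ∃ n, f i n ≤ g n := by
  by_contra! h
  refine hι.not_ge (le_trans ?_ (Cardinal.mk_range_le (f := f)))
  refine csInf_le' ⟨range f, fun g => ?_, rfl⟩
  obtain ⟨i, hi⟩ := h g
  exact ⟨f i, ⟨i, rfl⟩, Eventually.of_forall fun n => (hi n).le⟩

theorem aleph0_lt_frakd : Cardinal.aleph0 < frakd := by
  by_contra! h
  obtain ⟨D, hD, hDc⟩ := exists_dominating_mk_eq_frakd
  rw [← hDc, Cardinal.mk_le_aleph0_iff] at h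
  obtain ⟨f₀, hf₀, -⟩ := hD 0
  obtain ⟨e, rfl⟩ := (Set.countable_coe_iff.1 h).exists_eq_range ⟨f₀, hf₀⟩
  obtain ⟨_, ⟨i, rfl⟩, hi⟩ := hD fun n => partialSups (fun i => e i n) n + 1
  obtain ⟨n, hn, hin⟩ := (hi.and (eventually_ge_atTop i)).exists
  have := le_partialSups_of_le (fun i => e i n) hin
  lia

theorem AddSubgroup.mk_closure_le (B : Set (ℕ → ℤ)) :
    Cardinal.mk (AddSubgroup.closure B) ≤ max Cardinal.aleph0 (Cardinal.mk ↥(B ∪ -B)) := by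
  have h : ((AddSubgroup.closure B : AddSubgroup (ℕ → ℤ)) : Set (ℕ → ℤ)) =
      range (FreeAddMonoid.lift ((↑) : ↥(B ∪ -B) → ℕ → ℤ)) := by
    rw [← AddSubgroup.coe_toAddSubmonoid, AddSubgroup.closure_toAddSubmonoid,
      AddSubmonoid.closure_eq_mrange]
    rfl
  calc Cardinal.mk ((AddSubgroup.closure B : AddSubgroup (ℕ → ℤ)) : Set (ℕ → ℤ))
      ≤ Cardinal.mk (List ↥(B ∪ -B)) := by
        rw [h]
        exact Cardinal.mk_range_le
    _ ≤ _ := Cardinal.mk_list_le_max _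

theorem exists_unbounded_menger_of_unbounded {B : Set (ℕ → ℕ)} (hB : Cardinal.mk B < frakd)
    (hBu : ∀ g : ℕ → ℕ, ∃ f ∈ B, ∃ᶠ n in atTop, g n < f n) :
    ∃ H : AddSubgroup (ℕ → ℤ), (∀ f : ℕ → ℕ, ∃ x ∈ H, ∃ᶠ n in atTop, (f n : ℤ) < |x n|) ∧
      ∀ K : Set (ℕ → ℤ), IsCompact K → MengerOn ((H : Set (ℕ → ℤ)) + K) := by
  let B' : Set (ℕ → ℤ) := (fun f n => (f n : ℤ)) '' B
  refine ⟨AddSubgroup.closure B', fun g => ?_, fun K hK => ?_⟩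
  · obtain ⟨f, hf, hgf⟩ := hBu g
    refine ⟨_, AddSubgroup.subset_closure ⟨f, hf, rfl⟩, hgf.mono fun n hn => ?_⟩
    rw [Nat.abs_cast]
    exact_mod_cast hn
  · have hB' : Cardinal.mk B' < frakd := Cardinal.mk_image_le.trans_lt hB
    have hnB' : Cardinal.mk ↥(-B') < frakd := by
      rw [← Set.image_neg_eq_neg]
      exact Cardinal.mk_image_le.trans_lt hB'
    have hH : Cardinal.mk (AddSubgroup.closure B') < frakd :=
      (AddSubgroup.mk_closure_le B').trans_lt (max_lt aleph0_lt_frakd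
        ((Cardinal.mk_union_le _ _).trans_lt (Cardinal.add_lt_of_lt aleph0_lt_frakd.le hB' hnB')))
    have : ((AddSubgroup.closure B' : AddSubgroup (ℕ → ℤ)) : Set (ℕ → ℤ)) + K =
        ⋃ h : AddSubgroup.closure B', ({(h : ℕ → ℤ)} + K) := by
      rw [← Set.iUnion_add, Set.iUnion_singleton_eq_range, Subtype.range_coe]
    rw [this]
    exact MengerOn.iUnion_of_isCompact (exists_forall_exists_le_of_mk_lt_frakd hH)
      fun h => isCompact_singleton.add hK

theorem closure_add_eq_iUnion_sumsAdd {Y : Set (ℕ → ℤ)} (hY : -Y ⊆ Y) (K : Set (ℕ → ℤ)) :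
    ((AddSubgroup.closure Y : AddSubgroup (ℕ → ℤ)) : Set (ℕ → ℤ)) + K = ⋃ k, sumsAdd Y k K := by
  apply Subset.antisymm
  · rintro _ ⟨x, hx, z, hz, rfl⟩
    rw [← AddSubgroup.coe_toAddSubmonoid, AddSubgroup.closure_toAddSubmonoid,
      union_eq_left.2 hY] at hx
    obtain ⟨l, hl, rfl⟩ := AddSubmonoid.exists_multiset_of_mem_closure hx
    exact mem_iUnion.2 ⟨_, l, rfl, hl, z, hz, rfl⟩
  · refine iUnion_subset fun k => ?_
    rintro _ ⟨l, -, hl, z, hz, rfl⟩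
    exact Set.add_mem_add
      (AddSubgroup.multiset_sum_mem _ _ fun y hy => AddSubgroup.subset_closure (hl y hy)) hz

theorem exists_unbounded_menger_of_bounded
    (hb : ∀ B : Set (ℕ → ℕ), Cardinal.mk B < frakd →
      ∃ g : ℕ → ℕ, ∀ f ∈ B, ∀ᶠ n in atTop, f n ≤ g n) :
    ∃ H : AddSubgroup (ℕ → ℤ), (∀ f : ℕ → ℕ, ∃ x ∈ H, ∃ᶠ n in atTop, (f n : ℤ) < |x n|) ∧
      ∀ K : Set (ℕ → ℤ), IsCompact K → MengerOn ((H : Set (ℕ → ℤ)) + K) := by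
  obtain ⟨D, hD, hDc⟩ := exists_dominating_mk_eq_frakd
  obtain ⟨e⟩ : Nonempty (frakd.ord.ToType ≃ D) := Cardinal.eq.1 (by simp [hDc])
  have hIio : ∀ i : frakd.ord.ToType, Cardinal.mk (Iio i) < frakd := fun i => by
    simpa using Cardinal.mk_Iio_lt i (by simp)
  have hg : ∀ i : frakd.ord.ToType, ∃ g : ℕ → ℕ,
      ∀ j ≤ i, ∀ᶠ n in atTop, (e j : ℕ → ℕ) n ≤ g n := by
    intro i
    obtain ⟨g, hg⟩ := hb ((fun j => (e j : ℕ → ℕ)) '' Iio i)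
      (Cardinal.mk_image_le.trans_lt (hIio i))
    refine ⟨g ⊔ e i, fun j hj => ?_⟩
    rcases hj.eq_or_lt with rfl | hj
    · exact Eventually.of_forall fun n => le_max_right _ _
    · exact (hg _ ⟨j, hj, rfl⟩).mono fun n hn => hn.trans (le_max_left _ _)
  choose g hg using hg
  choose y hy hy' using fun i => exists_gaps_and_large (g i)
  let Y : Set (ℕ → ℤ) := (⋃ n, ⋃ b, box n b) ∪ (range y ∪ -range y)
  have hYneg : -Y ⊆ Y := by
    simp only [Y, Set.union_neg, neg_neg, Set.iUnion_neg]
    refine union_subset_union (iUnion_mono fun n => iUnion_mono fun b x hx => ?_)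
      (union_comm _ _).subset
    simpa [box] using hx
  have hboxY : ∀ n b, box n b ⊆ Y := fun n b x hx =>
    Or.inl (mem_iUnion.2 ⟨n, mem_iUnion.2 ⟨b, hx⟩⟩)
  refine ⟨AddSubgroup.closure Y, fun f => ?_, fun K hK => ?_⟩
  · obtain ⟨f', hf', hff'⟩ := hD f
    obtain ⟨i, hi⟩ := e.surjective ⟨f', hf'⟩
    refine ⟨y i, AddSubgroup.subset_closure (Or.inr (Or.inl ⟨i, rfl⟩)), ?_⟩
    refine ((hy' i).and_eventually ((hg i i le_rfl).and hff')).mono fun n hn => ?_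
    obtain ⟨h1, h2, h3⟩ := hn
    rw [hi] at h2
    exact lt_of_le_of_lt (by exact_mod_cast h3.trans h2) h1
  · rw [closure_add_eq_iUnion_sumsAdd hYneg]
    refine MengerOn.iUnion_nat fun k => mengerOn_sumsAdd hboxY (fun h => ?_) k hK
    obtain ⟨f, hf, hhf⟩ := hD h
    obtain ⟨i, hi⟩ := e.surjective ⟨f, hf⟩
    let S : Set (ℕ → ℤ) := y '' Iio i ∪ -(y '' Iio i)
    have hS₁ : Cardinal.mk ↥(y '' Iio i) < frakd :=
      Cardinal.mk_image_le.trans_lt (hIio i)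
    have hS₂ : Cardinal.mk ↥(-(y '' Iio i)) < frakd := by
      rw [← Set.image_neg_eq_neg]
      exact Cardinal.mk_image_le.trans_lt hS₁
    have hS : Cardinal.mk S < frakd :=
      (Cardinal.mk_union_le _ _).trans_lt (Cardinal.add_lt_of_lt aleph0_lt_frakd.le hS₁ hS₂)
    have hgap : ∀ j, ¬ j < i → ∀ᶠ n in (hyperfilter ℕ : Filter ℕ), IsGap h (y j) n := by
      intro j hj
      have h1 : ∀ᶠ n in atTop, h n ≤ g j n := by
        filter_upwards [hhf, hg j i (not_lt.1 hj)] with n hn hn'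
        rw [hi] at hn'
        exact hn.trans hn'
      have h2 : (hyperfilter ℕ : Filter ℕ) ≤ atTop :=
        Nat.cofinite_eq_atTop ▸ hyperfilter_le_cofinite
      filter_upwards [hy j, h2 h1] with n hn hn'
      exact hn.mono hn'
    refine ⟨S, ?_, fun f => ?_, ?_⟩
    · exact subset_union_of_subset_right (union_subset_union (image_subset_range _ _)
        (Set.neg_subset_neg.2 (image_subset_range _ _))) _
    · obtain ⟨g', hg'⟩ := hb (range f) (Cardinal.mk_range_le.trans_lt hS)
      exact ⟨g', fun s => hg' _ ⟨s, rfl⟩⟩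
    · rintro x (hx | ⟨j, rfl⟩ | ⟨j, hj⟩) hxS
      · obtain ⟨n, hx⟩ := mem_iUnion.1 hx
        obtain ⟨b, hx⟩ := mem_iUnion.1 hx
        exact eventually_isGap_of_mem_box hx h
      · exact hgap j fun hji => hxS (Or.inl ⟨j, hji, rfl⟩)
      · obtain rfl : x = -y j := by rw [hj, neg_neg]
        exact (hgap j fun hji => hxS (Or.inr ⟨j, hji, (neg_neg _).symm⟩)).mono fun n hn => hn.neg

theorem stmt_17 :
    ∃ G : AddSubgroup (ℕ → ℤ), HasMenger ↥G ∧ MengerBounded ↥G ∧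
      ¬ HurewiczBounded ↥G ∧ ¬ RothbergerBounded ↥G := by
  obtain ⟨H, hH, hM⟩ : ∃ H : AddSubgroup (ℕ → ℤ),
      (∀ f : ℕ → ℕ, ∃ x ∈ H, ∃ᶠ n in atTop, (f n : ℤ) < |x n|) ∧
      ∀ K : Set (ℕ → ℤ), IsCompact K → MengerOn ((H : Set (ℕ → ℤ)) + K) := by
    by_cases hb : ∀ B : Set (ℕ → ℕ), Cardinal.mk B < frakd →
        ∃ g : ℕ → ℕ, ∀ f ∈ B, ∀ᶠ n in atTop, f n ≤ g n
    · exact exists_unbounded_menger_of_bounded hb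
    · push Not at hb
      obtain ⟨B, hB, hBu⟩ := hb
      exact exists_unbounded_menger_of_unbounded hB hBu
  exact exists_subgroup_of_unbounded hH hM
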